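/- Let x̄₁,…,x̄_N be unbiased estimators of a random vector x (E[x̄ᵢ − x] = 0) with covariance matrices cov(x̄ᵢ − x) = Pᵢ (positive definite), with arbitrary (unknown) cross-covariances. Let λ₁,…,λ_N ≥ 0 with Σᵢ λᵢ = 1, set Q = Σᵢ λᵢ Pᵢ⁻¹ (assumed invertible), and x̂ = Q⁻¹ Σᵢ λᵢ Pᵢ⁻¹ x̄ᵢ. Then cov(x̂ − x) ⪯ Q⁻¹ (covariance intersection consistency). -/

import Mathlib

open Matrix

/-- Jensen's inequality for the quadratic form of a positive semidefinite matrix, at the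
standard basis vectors. -/
lemma Matrix.PosSemidef.dotProduct_mulVec_le_sum_diag {ι : Type*} [Fintype ι] [DecidableEq ι]
    {F : Matrix ι ι ℝ} (hF : F.PosSemidef) {l : ι → ℝ} (hl : ∀ i, 0 ≤ l i)
    (hlsum : ∑ i, l i = 1) : l ⬝ᵥ F *ᵥ l ≤ ∑ i, l i * F i i := by
  have key : 0 ≤ ∑ i, l i * ((Pi.single i 1 - l) ⬝ᵥ F *ᵥ (Pi.single i 1 - l)) :=
    Finset.sum_nonneg fun i _ => mul_nonneg (hl i) <| by
      simpa only [star_trivial] using hF.dotProduct_mulVec_nonneg (Pi.single i 1 - l)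
  have expand : ∀ i, l i * ((Pi.single i 1 - l) ⬝ᵥ F *ᵥ (Pi.single i 1 - l)) =
      l i * F i i - l i * (F *ᵥ l) i - (l ᵥ* F) i * l i + l i * (l ⬝ᵥ F *ᵥ l) := by
    intro i
    have h : l ⬝ᵥ F *ᵥ Pi.single i 1 = (l ᵥ* F) i := by
      rw [dotProduct_mulVec, dotProduct_single, mul_one]
    rw [mulVec_sub, sub_dotProduct, dotProduct_sub, dotProduct_sub, h]
    simp only [single_one_dotProduct, mulVec_single_one, col_apply]
    ring
  simp only [expand, Finset.sum_add_distrib, Finset.sum_sub_distrib, ← Finset.sum_mul, hlsum]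
    at key
  have h1 : ∑ i, l i * (F *ᵥ l) i = l ⬝ᵥ F *ᵥ l := rfl
  have h2 : ∑ i, (l ᵥ* F) i * l i = l ⬝ᵥ F *ᵥ l := (dotProduct_mulVec l F l).symm
  linarith

/-- Compressing a positive semidefinite block matrix along one vector per block gives a positive
semidefinite matrix. -/
lemma Matrix.PosSemidef.of_blocks {ι m : Type*} [Fintype ι] [Fintype m]
    {S : ι → ι → Matrix m m ℝ}
    (hS : (Matrix.of fun (p q : ι × m) => S p.1 q.1 p.2 q.2).PosSemidef) (y : ι → m → ℝ) :
    (Matrix.of fun i j => y i ⬝ᵥ S i j *ᵥ y j).PosSemidef := by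
  classical
  convert hS.conjTranspose_mul_mul_same
    (Matrix.of fun (p : ι × m) (i : ι) => if p.1 = i then y i p.2 else 0) using 1
  ext i j
  simp only [of_apply, mul_apply, conjTranspose_apply, Fintype.sum_prod_type, dotProduct, mulVec,
    star_trivial, ite_mul, mul_ite, zero_mul, mul_zero, Finset.sum_ite_irrel,
    Finset.sum_const_zero, Finset.sum_ite_eq', Finset.mem_univ, if_true,
    Finset.mul_sum, Finset.sum_mul]
  rw [Finset.sum_comm]
  simp only [mul_assoc]

/-- covariance intersection consistency, algebraic form: Let the error
covariances of `N` unbiased estimators be `Σ i j = cov(x̄ᵢ − x, x̄ⱼ − x)` with diagonal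
blocks `Σ i i = Pᵢ` positive definite, arbitrary cross-covariances subject only to the
joint error covariance (the block matrix with blocks `Σ i j`) being positive
semidefinite. Let `λᵢ ≥ 0` with `Σᵢ λᵢ = 1`, `Q = Σᵢ λᵢ Pᵢ⁻¹` invertible (positive
definite), and let the fusion be `x̂ = Q⁻¹ Σᵢ λᵢ Pᵢ⁻¹ x̄ᵢ`, whose error covariance is
`cov(x̂ − x) = Σᵢ Σⱼ Kᵢ Σᵢⱼ Kⱼᵀ` with gains `Kᵢ = λᵢ Q⁻¹ Pᵢ⁻¹`. Then
`cov(x̂ − x) ⪯ Q⁻¹`. -/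
theorem stmt15 {n N : ℕ} (P : Fin N → Matrix (Fin n) (Fin n) ℝ)
    (hP : ∀ i, (P i).PosDef)
    (Sig : Fin N → Fin N → Matrix (Fin n) (Fin n) ℝ)
    (hdiag : ∀ i, Sig i i = P i)
    (hjoint : (Matrix.of fun (p q : Fin N × Fin n) => Sig p.1 q.1 p.2 q.2).PosSemidef)
    (l : Fin N → ℝ) (hl : ∀ i, 0 ≤ l i) (hlsum : ∑ i, l i = 1)
    (Q : Matrix (Fin n) (Fin n) ℝ) (hQ : Q = ∑ i, l i • (P i)⁻¹) (hQpd : Q.PosDef)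
    (K : Fin N → Matrix (Fin n) (Fin n) ℝ) (hK : ∀ i, K i = l i • (Q⁻¹ * (P i)⁻¹))
    (covErr : Matrix (Fin n) (Fin n) ℝ)
    (hcov : covErr = ∑ i, ∑ j, K i * Sig i j * (K j)ᵀ) :
    (Q⁻¹ - covErr).PosSemidef := by
  have hSig : ∀ i j, (Sig i j)ᵀ = Sig j i := by
    intro i j
    ext a b
    simpa using hjoint.isHermitian.apply (j, a) (i, b)
  have hPt : ∀ i, ((P i)⁻¹)ᵀ = (P i)⁻¹ := fun i => by
    simpa using (hP i).isHermitian.inv.eq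
  have hQt : (Q⁻¹)ᵀ = Q⁻¹ := by simpa using hQpd.isHermitian.inv.eq
  have hcovt : covErrᵀ = covErr := by
    simp only [hcov, transpose_sum, transpose_mul, transpose_transpose, hSig]
    rw [Finset.sum_comm]
    simp only [Matrix.mul_assoc]
  refine PosSemidef.of_dotProduct_mulVec_nonneg ?_ fun x => ?_
  · simp [IsHermitian, conjTranspose_eq_transpose_of_trivial, hQt, hcovt]
  set a := Q⁻¹ *ᵥ x with ha
  set y : Fin N → Fin n → ℝ := fun i => (P i)⁻¹ *ᵥ a with hy
  have hKx : ∀ i, (K i)ᵀ *ᵥ x = l i • y i := by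
    intro i
    rw [hK, transpose_smul, transpose_mul, hPt, hQt, smul_mulVec, ← mulVec_mulVec]
  have hterm : ∀ i j, x ⬝ᵥ (K i * Sig i j * (K j)ᵀ) *ᵥ x =
      l i * ((y i ⬝ᵥ Sig i j *ᵥ y j) * l j) := by
    intro i j
    rw [← mulVec_mulVec, ← mulVec_mulVec, dotProduct_mulVec, ← mulVec_transpose, hKx, hKx,
      mulVec_smul, smul_dotProduct, dotProduct_smul, smul_eq_mul, smul_eq_mul]
    ring
  have hform : x ⬝ᵥ covErr *ᵥ x =
      l ⬝ᵥ (Matrix.of fun i j => y i ⬝ᵥ Sig i j *ᵥ y j) *ᵥ l := by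
    simp only [hcov, sum_mulVec, dotProduct_sum, hterm]
    simp only [dotProduct, mulVec, of_apply, Finset.mul_sum]
  have hdiagval : ∀ i, y i ⬝ᵥ Sig i i *ᵥ y i = a ⬝ᵥ (P i)⁻¹ *ᵥ a := by
    intro i
    rw [hdiag, hy, mulVec_mulVec, mul_nonsing_inv _ ((isUnit_iff_isUnit_det _).1 (hP i).isUnit),
      one_mulVec, dotProduct_comm]
  have hsum : ∑ i, l i * (y i ⬝ᵥ Sig i i *ᵥ y i) = x ⬝ᵥ Q⁻¹ *ᵥ x := by
    calc ∑ i, l i * (y i ⬝ᵥ Sig i i *ᵥ y i) = a ⬝ᵥ Q *ᵥ a := by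
          simp only [hdiagval, hQ, sum_mulVec, dotProduct_sum, smul_mulVec, dotProduct_smul,
            smul_eq_mul]
      _ = x ⬝ᵥ Q⁻¹ *ᵥ x := by
          rw [ha, mulVec_mulVec, mul_nonsing_inv _ ((isUnit_iff_isUnit_det _).1 hQpd.isUnit),
            one_mulVec, dotProduct_comm]
  have hle := (PosSemidef.of_blocks hjoint y).dotProduct_mulVec_le_sum_diag hl hlsum
  simp only [of_apply, hsum] at hle
  rw [star_trivial, sub_mulVec, dotProduct_sub, hform]
  linarith
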